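/- arXiv:1203.2742 — 2 statements merged into one kernel-verified Lean document; each statement's English description precedes it below -/
import Mathlib

section
/- Let V be a filled sparsity pattern on {1,…,n}. If vertex j is an ancestor of vertex k in the elimination tree of V, then I_k ∩ {j, j+1, …, n} ⊆ I⁺_j. -/
/-- A sparsity pattern on `{1,…,n}`: a set of pairs `(i,j)` with `n ≥ i > j ≥ 1`. -/
def IsPattern (n : ℕ) (V : Finset (ℕ × ℕ)) : Prop :=
  ∀ p ∈ V, 1 ≤ p.2 ∧ p.2 < p.1 ∧ p.1 ≤ n

/-- A pattern is filled (chordal) if `i > j > k`, `(i,k) ∈ V`, `(j,k) ∈ V` imply `(i,j) ∈ V`. -/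
def IsFilled (V : Finset (ℕ × ℕ)) : Prop :=
  ∀ i j k : ℕ, k < j → j < i → (i, k) ∈ V → (j, k) ∈ V → (i, j) ∈ V

/-- `I_k = {i : i > k, (i,k) ∈ V}`. -/
def lowerNbrs (V : Finset (ℕ × ℕ)) (k : ℕ) : Finset ℕ :=
  (V.filter (fun p => p.2 = k ∧ k < p.1)).image Prod.fst

/-- `I⁺_k = {k} ∪ I_k`. -/
def lowerNbrsPlus (V : Finset (ℕ × ℕ)) (k : ℕ) : Finset ℕ :=
  insert k (lowerNbrs V k)

/-- `j` is the parent of `k` in the elimination tree: `I_k ≠ ∅` and `j = min I_k`. -/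
def ParentOf (V : Finset (ℕ × ℕ)) (j k : ℕ) : Prop :=
  j ∈ lowerNbrs V k ∧ ∀ i ∈ lowerNbrs V k, j ≤ i

/-- `j` is an ancestor of `k`: `j` is obtained from `k` by iterating the parent map
zero or more times. -/
def EtreeAncestor (V : Finset (ℕ × ℕ)) (j k : ℕ) : Prop :=
  Relation.ReflTransGen (fun a b => ParentOf V b a) k j

/-- `j` is a proper ancestor of `k`: obtained by iterating the parent map at least once. -/
def EtreeProperAncestor (V : Finset (ℕ × ℕ)) (j k : ℕ) : Prop :=
  Relation.TransGen (fun a b => ParentOf V b a) k j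

/-- A set `W` of vertices is complete for `V`: all pairs in `W` are joined in `V`. -/
def IsCompleteSet (V : Finset (ℕ × ℕ)) (W : Finset ℕ) : Prop :=
  ∀ i ∈ W, ∀ j ∈ W, j < i → (i, j) ∈ V

/-- A clique: a complete subset of `{1,…,n}` maximal with respect to inclusion. -/
def IsCliqueOf (n : ℕ) (V : Finset (ℕ × ℕ)) (W : Finset ℕ) : Prop :=
  W ⊆ Finset.Icc 1 n ∧ IsCompleteSet V W ∧
    ∀ W' ⊆ Finset.Icc 1 n, IsCompleteSet V W' → W ⊆ W' → W = W'

theorem mem_lowerNbrs_iff (V : Finset (ℕ × ℕ)) (k i : ℕ) :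
    i ∈ lowerNbrs V k ↔ (i, k) ∈ V ∧ k < i := by
  simp only [lowerNbrs, Finset.mem_image, Finset.mem_filter, Prod.exists]
  constructor
  · rintro ⟨a, b, ⟨h1, rfl, h3⟩, rfl⟩
    exact ⟨h1, h3⟩
  · rintro ⟨h1, h2⟩
    exact ⟨i, k, ⟨h1, rfl, h2⟩, rfl⟩

/-- If `j` is an ancestor of `k` in the elimination tree, then
`I_k ∩ {j, j+1, …, n} ⊆ I⁺_j`. -/
theorem stmt_1 (n : ℕ) (hn : 1 ≤ n) (V : Finset (ℕ × ℕ))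
    (hV : IsPattern n V) (hF : IsFilled V) (j k : ℕ)
    (h : EtreeAncestor V j k) :
    lowerNbrs V k ∩ Finset.Icc j n ⊆ lowerNbrsPlus V j := by
  intro i hi
  rw [Finset.mem_inter, Finset.mem_Icc] at hi
  obtain ⟨hik, hji, -⟩ := hi
  rw [lowerNbrsPlus, Finset.mem_insert]
  unfold EtreeAncestor at h
  induction h with
  | refl => exact Or.inr hik
  | @tail b c _ hbc ih =>
    have hc := (mem_lowerNbrs_iff V b c).1 hbc.1
    rcases ih (by omega) with hib | hib
    · omega
    · rcases Nat.eq_or_lt_of_le hji with e | hlt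
      · exact Or.inl e.symm
      · right
        rw [mem_lowerNbrs_iff] at hib ⊢
        exact ⟨hF i c b hc.2 hlt hib.1 hc.1, hlt⟩
end

section
/- Let V be a filled sparsity pattern on {1,…,n} and let i_1, i_2, …, i_r be a path in the elimination tree of V from a vertex i_1 to one of its ancestors i_r, i.e., i_{s+1} is the parent of i_s for s = 1,…,r−1. Then I_{i_1} ⊆ {i_2, i_3, …, i_{r−1}} ∪ I⁺_{i_r} and |I_{i_1}| ≤ |I_{i_r}| + r − 1. -/
theorem mem_lowerNbrs_aux (V : Finset (ℕ × ℕ)) (k x : ℕ) :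
    x ∈ lowerNbrs V k ↔ (x, k) ∈ V ∧ k < x := by
  unfold lowerNbrs
  simp only [Finset.mem_image, Finset.mem_filter, Prod.exists]
  constructor
  · rintro ⟨a, b, ⟨h1, rfl, h3⟩, rfl⟩
    exact ⟨h1, h3⟩
  · rintro ⟨h1, h2⟩
    exact ⟨x, k, ⟨h1, rfl, h2⟩, rfl⟩

theorem parent_step_aux (V : Finset (ℕ × ℕ)) (hF : IsFilled V) (j k : ℕ)
    (h : ParentOf V j k) : lowerNbrs V k ⊆ insert j (lowerNbrs V j) := by
  intro x hx
  have hle := h.2 x hx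
  have hj := (mem_lowerNbrs_aux V k j).1 h.1
  have hx' := (mem_lowerNbrs_aux V k x).1 hx
  rcases hle.eq_or_lt with e | e
  · simp [e]
  · exact Finset.mem_insert_of_mem ((mem_lowerNbrs_aux V j x).2
      ⟨hF x j k hj.2 e hx'.1 hj.1, e⟩)

theorem path_aux (V : Finset (ℕ × ℕ)) (hF : IsFilled V) (i : ℕ → ℕ) (m : ℕ)
    (hpath : ∀ s, s < m → ParentOf V (i (s + 1)) (i s)) :
    (∀ x ∈ lowerNbrs V (i 0), (∃ s, 0 < s ∧ s ≤ m ∧ i s = x) ∨ x ∈ lowerNbrs V (i m)) ∧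
    (lowerNbrs V (i 0)).card ≤ (lowerNbrs V (i m)).card + m := by
  induction m with
  | zero => exact ⟨fun x hx => Or.inr hx, le_rfl⟩
  | succ m ih =>
    obtain ⟨h1, h2⟩ := ih (fun s hs => hpath s (by omega))
    have hst := parent_step_aux V hF _ _ (hpath m (by omega))
    constructor
    · intro x hx
      rcases h1 x hx with ⟨s, a, b, c⟩ | h
      · exact Or.inl ⟨s, a, by omega, c⟩
      · rcases Finset.mem_insert.1 (hst h) with e | e
        · exact Or.inl ⟨m + 1, by omega, le_rfl, e.symm⟩
        · exact Or.inr e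
    · have := (Finset.card_le_card hst).trans (Finset.card_insert_le _ _)
      omega

/-- Along a path `i 0, i 1, …, i (r-1)` in the elimination tree (each `i (s+1)` the parent
of `i s`), one has `I_{i 0} ⊆ {i 1, …, i (r-2)} ∪ I⁺_{i (r-1)}` and
`|I_{i 0}| ≤ |I_{i (r-1)}| + (r-1)`.  (The paper indexes the path `i_1,…,i_r`.) -/
theorem stmt_3 (n : ℕ) (hn : 1 ≤ n) (V : Finset (ℕ × ℕ))
    (hV : IsPattern n V) (hF : IsFilled V)
    (r : ℕ) (hr : 1 ≤ r) (i : ℕ → ℕ)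
    (hpath : ∀ s, s + 1 < r → ParentOf V (i (s + 1)) (i s)) :
    lowerNbrs V (i 0) ⊆ (Finset.Ioo 0 (r - 1)).image i ∪ lowerNbrsPlus V (i (r - 1)) ∧
    (lowerNbrs V (i 0)).card ≤ (lowerNbrs V (i (r - 1))).card + (r - 1) := by
  obtain ⟨h1, h2⟩ := path_aux V hF i (r - 1) (fun s hs => hpath s (by omega))
  refine ⟨?_, h2⟩
  intro x hx
  unfold lowerNbrsPlus
  simp only [Finset.mem_union, Finset.mem_image, Finset.mem_Ioo, Finset.mem_insert]
  rcases h1 x hx with ⟨s, a, b, c⟩ | h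
  · rcases b.eq_or_lt with e | e
    · right; left; rw [← c, e]
    · exact Or.inl ⟨s, ⟨a, e⟩, c⟩
  · exact Or.inr (Or.inr h)
end
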